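/- Let N ≥ 5 be an integer and p > 1 a real number. Let u ∈ C⁴(ℝ^N) be a classical stable solution of Δ²u = u^p, u > 0 in ℝ^N, and set v = −Δu. Then there exists a constant C > 0 (depending on u, N, p but not on R) such that ∫_{B_R} (v² + u^{p+1}) dx ≤ C · R^{N − 4 − 8/(p−1)} for every R > 0, where B_R is the ball of radius R centered at the origin. -/

import Mathlib

open MeasureTheory Real

/-- The Laplacian of a function on `ℝ^N` (sum of pure second derivatives). -/
noncomputable def lap {N : ℕ} (u : EuclideanSpace ℝ (Fin N) → ℝ)
    (x : EuclideanSpace ℝ (Fin N)) : ℝ :=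
  ∑ i : Fin N, fderiv ℝ (fun y => fderiv ℝ u y (EuclideanSpace.single i 1)) x
    (EuclideanSpace.single i 1)

open Filter Topology Set

/-- The partial derivative in the `i`-th coordinate direction. -/
noncomputable def pd {N : ℕ} (i : Fin N) (f : EuclideanSpace ℝ (Fin N) → ℝ)
    (x : EuclideanSpace ℝ (Fin N)) : ℝ :=
  fderiv ℝ f x (EuclideanSpace.single i 1)

section Calculus

variable {N : ℕ} {f g : EuclideanSpace ℝ (Fin N) → ℝ}

lemma lap_eq_sum_pd (f : EuclideanSpace ℝ (Fin N) → ℝ) (x : EuclideanSpace ℝ (Fin N)) :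
    lap f x = ∑ i, pd i (pd i f) x := rfl

lemma ContDiff.pd {m n : WithTop ℕ∞} (hf : ContDiff ℝ n f) (h : m + 1 ≤ n) (i : Fin N) :
    ContDiff ℝ m (pd i f) :=
  (hf.fderiv_right h).clm_apply contDiff_const

lemma ContDiff.lap {m n : WithTop ℕ∞} (hf : ContDiff ℝ n f) (h : m + 1 + 1 ≤ n) :
    ContDiff ℝ m (lap f) :=
  ContDiff.sum fun i _ => (hf.pd h i).pd le_rfl i

lemma HasCompactSupport.pd (hf : HasCompactSupport f) (i : Fin N) : HasCompactSupport (pd i f) :=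
  hf.fderiv_apply ℝ _

lemma HasCompactSupport.lap (hf : HasCompactSupport f) : HasCompactSupport (lap f) := by
  have h : _root_.lap f = ∑ i, _root_.pd i (_root_.pd i f) := by
    ext x; simp [lap_eq_sum_pd]
  rw [h]
  refine Finset.sum_induction _ HasCompactSupport (fun _ _ => HasCompactSupport.add)
    HasCompactSupport.zero fun i _ => (hf.pd i).pd i

lemma pd_mul (hf : Differentiable ℝ f) (hg : Differentiable ℝ g) (i : Fin N) :
    pd i (fun x => f x * g x) = fun x => f x * pd i g x + g x * pd i f x := by
  ext x
  simp [pd, fderiv_fun_mul (hf x) (hg x)]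

lemma pd_add (hf : Differentiable ℝ f) (hg : Differentiable ℝ g) (i : Fin N) :
    pd i (fun x => f x + g x) = fun x => pd i f x + pd i g x := by
  ext x
  simp [pd, fderiv_fun_add (hf x) (hg x)]

lemma lap_mul (hf : ContDiff ℝ 2 f) (hg : ContDiff ℝ 2 g) (x : EuclideanSpace ℝ (Fin N)) :
    lap (fun x => f x * g x) x
      = f x * lap g x + 2 * ∑ i, pd i f x * pd i g x + g x * lap f x := by
  have hf1 := hf.differentiable two_ne_zero
  have hg1 := hg.differentiable two_ne_zero
  have hf2 (i) : Differentiable ℝ (pd i f) :=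
    (hf.pd (m := 1) (by norm_num) i).differentiable one_ne_zero
  have hg2 (i) : Differentiable ℝ (pd i g) :=
    (hg.pd (m := 1) (by norm_num) i).differentiable one_ne_zero
  simp only [lap_eq_sum_pd, Finset.mul_sum, ← Finset.sum_add_distrib]
  refine Finset.sum_congr rfl fun i _ => ?_
  rw [pd_mul hf1 hg1, pd_add (hf1.fun_mul (hg2 i)) (hg1.fun_mul (hf2 i)), pd_mul hf1 (hg2 i),
    pd_mul hg1 (hf2 i)]
  ring

lemma pd_comp_smul (c : ℝ) (f : EuclideanSpace ℝ (Fin N) → ℝ) (i : Fin N) :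
    pd i (fun x => f (c • x)) = fun x => c * pd i f (c • x) := by
  ext x
  simp [pd, fderiv_comp_smul]

lemma pd_const_mul (c : ℝ) (hf : Differentiable ℝ f) (i : Fin N) :
    pd i (fun x => c * f x) = fun x => c * pd i f x := by
  ext x
  simp [pd, fderiv_const_mul (hf x)]

lemma lap_comp_smul (c : ℝ) (hf : ContDiff ℝ 2 f) :
    lap (fun x => f (c • x)) = fun x => c ^ 2 * lap f (c • x) := by
  ext x
  have hf2 (i) : Differentiable ℝ (pd i f) :=
    (hf.pd (m := 1) (by norm_num) i).differentiable one_ne_zero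
  simp only [lap_eq_sum_pd, Finset.mul_sum]
  refine Finset.sum_congr rfl fun i _ => ?_
  have h : Differentiable ℝ fun x => pd i f (c • x) :=
    (hf2 i).comp (differentiable_id.const_smul c)
  rw [pd_comp_smul, pd_const_mul _ h, pd_comp_smul]
  ring

lemma lap_const_mul (c : ℝ) (hf : ContDiff ℝ 2 f) :
    lap (fun x => c * f x) = fun x => c * lap f x := by
  ext x
  have hf2 (i) : Differentiable ℝ (pd i f) :=
    (hf.pd (m := 1) (by norm_num) i).differentiable one_ne_zero
  simp only [lap_eq_sum_pd, Finset.mul_sum]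
  refine Finset.sum_congr rfl fun i _ => ?_
  rw [pd_const_mul _ (hf.differentiable two_ne_zero), pd_const_mul _ (hf2 i)]

lemma integrable_mul_of_hasCompactSupport (hf : Continuous f) (hg : Continuous g)
    (hgc : HasCompactSupport g) : Integrable fun x => f x * g x :=
  (hf.mul hg).integrable_of_hasCompactSupport hgc.mul_left

lemma integral_mul_pd_eq (hf : ContDiff ℝ 1 f) (hg : ContDiff ℝ 1 g) (hgc : HasCompactSupport g)
    (i : Fin N) : ∫ x, f x * pd i g x = - ∫ x, pd i f x * g x := by
  have hf' : Continuous (pd i f) := (hf.pd (m := 0) (by norm_num) i).continuous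
  have hg' : Continuous (pd i g) := (hg.pd (m := 0) (by norm_num) i).continuous
  exact integral_mul_fderiv_eq_neg_fderiv_mul_of_integrable
    (integrable_mul_of_hasCompactSupport hf' hg.continuous hgc)
    (integrable_mul_of_hasCompactSupport hf.continuous hg' (hgc.pd i))
    (integrable_mul_of_hasCompactSupport hf.continuous hg.continuous hgc)
    (fun x _ => hf.differentiable one_ne_zero x) (fun x _ => hg.differentiable one_ne_zero x)

/-- Green's second identity on `ℝ^N`. -/
lemma integral_mul_lap_comm (hf : ContDiff ℝ 2 f) (hg : ContDiff ℝ 2 g)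
    (hgc : HasCompactSupport g) : ∫ x, f x * lap g x = ∫ x, lap f x * g x := by
  have hf1 (i) : ContDiff ℝ 1 (pd i f) := hf.pd (by norm_num) i
  have hg1 (i) : ContDiff ℝ 1 (pd i g) := hg.pd (by norm_num) i
  have hf2 (i) : Continuous (pd i (pd i f)) := ((hf1 i).pd (m := 0) (by norm_num) i).continuous
  have hg2 (i) : Continuous (pd i (pd i g)) := ((hg1 i).pd (m := 0) (by norm_num) i).continuous
  simp only [lap_eq_sum_pd, Finset.mul_sum, Finset.sum_mul]
  rw [integral_finsetSum _ fun i _ => integrable_mul_of_hasCompactSupport hf.continuous (hg2 i)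
      ((hgc.pd i).pd i),
    integral_finsetSum _ fun i _ => integrable_mul_of_hasCompactSupport (hf2 i) hg.continuous hgc]
  refine Finset.sum_congr rfl fun i _ => ?_
  rw [integral_mul_pd_eq (hf.of_le one_le_two) (hg1 i) (hgc.pd i),
    integral_mul_pd_eq (hf1 i) (hg.of_le one_le_two) hgc, neg_neg]

end Calculus

section Mollification

open scoped Convolution

open ContinuousLinearMap (lsmul)

variable {N : ℕ}

/-- A sequence of smooth bump functions at the origin with supports shrinking to a point. -/
noncomputable def bumpSeq (N n : ℕ) : ContDiffBump (0 : EuclideanSpace ℝ (Fin N)) where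
  rIn := 1 / (2 * (n + 1))
  rOut := 1 / (n + 1)
  rIn_pos := by positivity
  rIn_lt_rOut := by
    have : (0 : ℝ) < n + 1 := by positivity
    exact one_div_lt_one_div_of_lt this (by linarith)

/-- The mollification of `g` by the `n`-th bump function. -/
noncomputable def mollify (n : ℕ) (g : EuclideanSpace ℝ (Fin N) → ℝ) :
    EuclideanSpace ℝ (Fin N) → ℝ :=
  (bumpSeq N n).normed volume ⋆[lsmul ℝ ℝ, volume] g

variable {g a : EuclideanSpace ℝ (Fin N) → ℝ}

lemma bumpSeq_rOut (n : ℕ) : (bumpSeq N n).rOut = 1 / ((n : ℝ) + 1) := rfl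

lemma contDiff_mollify (n : ℕ) (hg : Continuous g) : ContDiff ℝ (⊤ : ℕ∞) (mollify n g) :=
  (bumpSeq N n).hasCompactSupport_normed.contDiff_convolution_left _
    (bumpSeq N n).contDiff_normed hg.locallyIntegrable

lemma hasCompactSupport_mollify (n : ℕ) (hgc : HasCompactSupport g) :
    HasCompactSupport (mollify n g) :=
  (bumpSeq N n).hasCompactSupport_normed.convolution _ hgc

lemma pd_mollify (n : ℕ) (hg : ContDiff ℝ 1 g) (hgc : HasCompactSupport g) (i : Fin N) :
    pd i (mollify n g) = mollify n (pd i g) := by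
  have hb : LocallyIntegrable ((bumpSeq N n).normed volume) volume :=
    (bumpSeq N n).continuous_normed.locallyIntegrable
  ext x
  unfold pd mollify
  rw [(hgc.hasFDerivAt_convolution_right (lsmul ℝ ℝ) hb hg x).fderiv,
    convolution_precompR_apply _ hb (hgc.fderiv ℝ) (hg.continuous_fderiv one_ne_zero)]

lemma lap_mollify (n : ℕ) (hg : ContDiff ℝ 2 g) (hgc : HasCompactSupport g) :
    lap (mollify n g) = mollify n (lap g) := by
  have hb : LocallyIntegrable ((bumpSeq N n).normed volume) volume :=
    (bumpSeq N n).continuous_normed.locallyIntegrable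
  have hg1 (i) : ContDiff ℝ 1 (pd i g) := hg.pd (by norm_num) i
  have hg2 (i) : Continuous (pd i (pd i g)) := ((hg1 i).pd (m := 0) (by norm_num) i).continuous
  ext x
  have hint (i) := ((hgc.pd i).pd i).convolutionExists_right (lsmul ℝ ℝ) hb (hg2 i) x
  simp only [lap_eq_sum_pd, pd_mollify n (hg.of_le one_le_two) hgc,
    pd_mollify n (hg1 _) (hgc.pd _)]
  simp only [mollify, convolution_def, lap_eq_sum_pd, map_sum]
  rw [integral_finsetSum _ fun i _ => hint i]

lemma tendsto_integral_mul_mollify_sq (ha : Continuous a) (hg : Continuous g)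
    (hgc : HasCompactSupport g) :
    Tendsto (fun n => ∫ x, a x * mollify n g x ^ 2) atTop (𝓝 (∫ x, a x * g x ^ 2)) := by
  obtain ⟨M, hM⟩ := hgc.exists_bound_of_continuous hg
  have hM0 : 0 ≤ M := (norm_nonneg _).trans (hM 0)
  obtain ⟨r, hr⟩ := hgc.isCompact.isBounded.subset_closedBall (0 : EuclideanSpace ℝ (Fin N))
  have hsupp (n x) (hx : x ∉ Metric.closedBall (0 : EuclideanSpace ℝ (Fin N)) (r + 1)) :
      mollify n g x = 0 := by
    have hzero (y) (hy : y ∈ Metric.ball x 1) : g y = 0 := by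
      by_contra hne
      have h1 := hr (subset_tsupport g hne)
      simp only [Metric.mem_closedBall, dist_zero_right, not_le, Metric.mem_ball] at *
      have : ‖x‖ ≤ ‖y‖ + dist y x := by
        rw [dist_comm, dist_eq_norm]; exact norm_le_norm_add_norm_sub' x y
      linarith
    have h0 : g x = 0 := hzero x (Metric.mem_ball_self one_pos)
    have := (bumpSeq N n).dist_normed_convolution_le (x₀ := x) (ε := 0) (μ := volume)
      hg.aestronglyMeasurable fun y hy => by
        rw [h0, hzero y, dist_self]
        refine Metric.ball_subset_ball ?_ hy
        rw [bumpSeq_rOut, div_le_one (by positivity)]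
        linarith [n.cast_nonneg (α := ℝ)]
    rw [h0, dist_le_zero] at this
    exact this
  have hbd (n x) : |mollify n g x| ≤ 3 * M := by
    have := (bumpSeq N n).dist_normed_convolution_le (x₀ := x) (ε := 2 * M) (μ := volume)
      hg.aestronglyMeasurable fun y _ => (dist_le_norm_add_norm _ _).trans (by
        linarith [hM x, hM y])
    rw [Real.dist_eq] at this
    have h2 := abs_sub_abs_le_abs_sub (mollify n g x) (g x)
    have h3 := hM x
    rw [Real.norm_eq_abs] at h3
    change |mollify n g x - g x| ≤ _ at this
    linarith
  refine tendsto_integral_of_dominated_convergence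
    ((Metric.closedBall 0 (r + 1)).indicator fun x => |a x| * (3 * M) ^ 2) (fun n => ?_) ?_
    (fun n => ae_of_all _ fun x => ?_) (ae_of_all _ fun x => ?_)
  · exact (ha.mul ((contDiff_mollify n hg).continuous.pow 2)).aestronglyMeasurable
  · rw [integrable_indicator_iff Metric.isClosed_closedBall.measurableSet]
    exact (ha.abs.mul continuous_const).continuousOn.integrableOn_compact
      (isCompact_closedBall _ _)
  · by_cases hx : x ∈ Metric.closedBall (0 : EuclideanSpace ℝ (Fin N)) (r + 1)
    · rw [indicator_of_mem hx, norm_mul, Real.norm_eq_abs, norm_pow, Real.norm_eq_abs]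
      gcongr
      exact hbd n x
    · simp [indicator_of_notMem hx, hsupp n x hx]
  · refine Tendsto.const_mul _ (Tendsto.pow ?_ 2)
    refine ContDiffBump.convolution_tendsto_right_of_continuous ?_ hg x
    simp only [bumpSeq_rOut]
    exact tendsto_one_div_add_atTop_nhds_zero_nat

/-- A weighted inequality `∫ a φ² ≤ ∫ (Δφ)²` for smooth test functions extends to test functions
of class `C²`. -/
lemma integral_mul_sq_le_of_contDiff_two (ha : Continuous a)
    (h : ∀ φ : EuclideanSpace ℝ (Fin N) → ℝ, ContDiff ℝ (⊤ : ℕ∞) φ → HasCompactSupport φ →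
      ∫ x, a x * φ x ^ 2 ≤ ∫ x, lap φ x ^ 2)
    (hg : ContDiff ℝ 2 g) (hgc : HasCompactSupport g) :
    ∫ x, a x * g x ^ 2 ≤ ∫ x, lap g x ^ 2 := by
  have h1 := tendsto_integral_mul_mollify_sq ha hg.continuous hgc
  have h2 := tendsto_integral_mul_mollify_sq (a := fun _ => 1) continuous_const
    (hg.lap (m := 0) (by norm_num)).continuous hgc.lap
  simp only [one_mul] at h2
  refine le_of_tendsto_of_tendsto' h1 h2 fun n => ?_
  rw [← lap_mollify n hg hgc]
  exact h _ (contDiff_mollify n hg.continuous) (hasCompactSupport_mollify n hgc)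

end Mollification

section Energy

variable {N : ℕ} {p : ℝ} {u φ : EuclideanSpace ℝ (Fin N) → ℝ}

lemma lap_mul_self (hu : ContDiff ℝ 2 u) (x : EuclideanSpace ℝ (Fin N)) :
    lap (fun x => u x * u x) x = 2 * u x * lap u x + 2 * ∑ i, pd i u x ^ 2 := by
  rw [lap_mul hu hu]
  simp only [sq]
  ring

lemma lap_mul_mul_self (hu : ContDiff ℝ 2 u) (hφ : ContDiff ℝ 2 φ)
    (x : EuclideanSpace ℝ (Fin N)) :
    lap (fun x => u x * (φ x * φ x)) x
      = φ x ^ 2 * lap u x + 4 * φ x * ∑ i, pd i u x * pd i φ x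
        + u x * (2 * φ x * lap φ x + 2 * ∑ i, pd i φ x ^ 2) := by
  have hφ1 := hφ.differentiable two_ne_zero
  have h : ∑ i, pd i u x * pd i (fun x => φ x * φ x) x
      = 2 * φ x * ∑ i, pd i u x * pd i φ x := by
    rw [Finset.mul_sum]
    refine Finset.sum_congr rfl fun i _ => ?_
    rw [pd_mul hφ1 hφ1]
    ring
  rw [lap_mul hu (hφ.mul hφ), lap_mul_self hφ, h]
  ring

/-- Two consequences of `[Δ(uφ)]² - Δu Δ(uφ²) = (2∇u·∇φ + uΔφ)² - 2uΔu|∇φ|²`. -/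
lemma lap_mul_sq_le (hu : ContDiff ℝ 2 u) (hφ : ContDiff ℝ 2 φ) (x : EuclideanSpace ℝ (Fin N)) :
    lap (fun x => u x * φ x) x ^ 2 ≤ lap u x * lap (fun x => u x * (φ x * φ x)) x
        + 8 * ((∑ i, pd i u x ^ 2) * ∑ i, pd i φ x ^ 2) + 2 * (u x ^ 2 * lap φ x ^ 2)
        + 2 * (|u x * lap u x| * ∑ i, pd i φ x ^ 2) ∧
      lap u x ^ 2 * φ x ^ 2 ≤ 2 * lap (fun x => u x * φ x) x ^ 2
        + 16 * ((∑ i, pd i u x ^ 2) * ∑ i, pd i φ x ^ 2) + 4 * (u x ^ 2 * lap φ x ^ 2) := by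
  rw [lap_mul_mul_self hu hφ, lap_mul hu hφ]
  have hcs := Finset.sum_mul_sq_le_sq_mul_sq Finset.univ (fun i => pd i u x) (fun i => pd i φ x)
  have hw : 0 ≤ ∑ i, pd i φ x ^ 2 := Finset.sum_nonneg fun i _ => sq_nonneg _
  generalize (∑ i, pd i φ x ^ 2) = w at *
  generalize (∑ i, pd i u x ^ 2) = e at *
  generalize (∑ i, pd i u x * pd i φ x) = s at *
  have habs : -(u x * lap u x) * w ≤ |u x * lap u x| * w :=
    mul_le_mul_of_nonneg_right (neg_le_abs _) hw
  constructor
  · nlinarith [sq_nonneg (2 * s - u x * lap φ x)]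
  · nlinarith [sq_nonneg (2 * s - u x * lap φ x),
      sq_nonneg (u x * lap φ x + 2 * s + φ x * lap u x + (2 * s + u x * lap φ x))]

/-- Weighted energy estimate for stable solutions, with a constant depending only on `p`. -/
lemma exists_energy_le (hp : 1 < p) : ∃ C : ℝ, 0 < C ∧
    ∀ (u : EuclideanSpace ℝ (Fin N) → ℝ), ContDiff ℝ 4 u → (∀ x, 0 < u x) →
    (∀ x, lap (lap u) x = u x ^ p) →
    (∀ ψ : EuclideanSpace ℝ (Fin N) → ℝ, ContDiff ℝ 2 ψ → HasCompactSupport ψ →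
      ∫ x, p * u x ^ (p - 1) * ψ x ^ 2 ≤ ∫ x, lap ψ x ^ 2) →
    ∀ φ q : EuclideanSpace ℝ (Fin N) → ℝ, ContDiff ℝ 3 φ → HasCompactSupport φ →
    Continuous q → HasCompactSupport q →
    (∀ x, (∑ i, pd i φ x ^ 2) ^ 2 ≤ q x * φ x ^ 2) → (∀ x, lap φ x ^ 2 ≤ q x) →
    (∀ x, |lap (fun y => ∑ i, pd i φ y ^ 2) x| ≤ q x) →
    (∫ x, lap u x ^ 2 * φ x ^ 2) + (∫ x, u x ^ (p + 1) * φ x ^ 2) ≤ C * ∫ x, u x ^ 2 * q x := by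
  set t : ℝ := 1 / (p - 1) with ht
  have hp1 : 0 < p - 1 := by linarith
  have ht0 : 0 < t := by positivity
  set κ : ℝ := 36 + 20 * t with hκ
  have hκ1 : 1 ≤ κ := by linarith
  refine ⟨(1 + 5 * t) * (48 + 24 * t + κ ^ 2) + 6 * t + 5 * t * κ, by positivity, ?_⟩
  intro u hu hpos heq hstab φ q hφ hφc hq hqc hw hlap hlapw
  have hu2 : ContDiff ℝ 2 u := hu.of_le (by norm_num)
  have hφ2 : ContDiff ℝ 2 φ := hφ.of_le (by norm_num)
  have hLu : ContDiff ℝ 2 (lap u) := hu.lap (by norm_num)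
  have huc := hu.continuous
  have hφcont := hφ.continuous
  have hLuc := hLu.continuous
  set w : EuclideanSpace ℝ (Fin N) → ℝ := fun y => ∑ i, pd i φ y ^ 2 with hwdef
  set e : EuclideanSpace ℝ (Fin N) → ℝ := fun y => ∑ i, pd i u y ^ 2 with hedef
  have hw2 : ContDiff ℝ 2 w := ContDiff.sum fun i _ => (hφ.pd (by norm_num) i).pow 2
  have hec : Continuous e := continuous_finsetSum _ fun i _ =>
    (hu.pd (m := 0) (by norm_num) i).continuous.pow 2
  have hw0 (x) : 0 ≤ w x := Finset.sum_nonneg fun i _ => sq_nonneg _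
  have hwc : HasCompactSupport w := by
    have h : w = ∑ i, fun y => pd i φ y * pd i φ y := by ext x; simp [hwdef, sq]
    rw [h]
    exact Finset.sum_induction _ HasCompactSupport (fun _ _ => HasCompactSupport.add)
      HasCompactSupport.zero fun i _ => (hφc.pd i).mul_left
  have hφφc : HasCompactSupport fun x => φ x * φ x := hφc.mul_left
  have hφsc : HasCompactSupport fun x => φ x ^ 2 := by simpa only [sq] using hφφc
  have huφ : ContDiff ℝ 2 fun x => u x * φ x := hu2.mul hφ2
  have huφc : HasCompactSupport fun x => u x * φ x := hφc.mul_left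
  have huφφ : ContDiff ℝ 2 fun x => u x * (φ x * φ x) := hu2.mul (hφ2.mul hφ2)
  have huφφc : HasCompactSupport fun x => u x * (φ x * φ x) := hφφc.mul_left
  have iL : Integrable fun x => lap (fun x => u x * φ x) x ^ 2 := by
    simpa only [sq] using integrable_mul_of_hasCompactSupport
      (huφ.lap (m := 0) (by norm_num)).continuous (huφ.lap (m := 0) (by norm_num)).continuous
      huφc.lap
  have iM : Integrable fun x => lap u x * lap (fun x => u x * (φ x * φ x)) x :=
    integrable_mul_of_hasCompactSupport hLuc (huφφ.lap (m := 0) (by norm_num)).continuous huφφc.lap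
  have iA : Integrable fun x => lap u x ^ 2 * φ x ^ 2 :=
    integrable_mul_of_hasCompactSupport (hLuc.pow 2) (hφcont.pow 2) hφsc
  have iQ : Integrable fun x => u x ^ 2 * q x :=
    integrable_mul_of_hasCompactSupport (huc.pow 2) hq hqc
  have iB : Integrable fun x => |u x * lap u x| * w x :=
    integrable_mul_of_hasCompactSupport (huc.mul hLuc).abs hw2.continuous hwc
  have iG : Integrable fun x => e x * w x :=
    integrable_mul_of_hasCompactSupport hec hw2.continuous hwc
  have iW : Integrable fun x => lap (fun x => u x * u x) x * w x :=
    integrable_mul_of_hasCompactSupport ((hu2.mul hu2).lap (m := 0) (by norm_num)).continuous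
      hw2.continuous hwc
  have iW' : Integrable fun x => u x * u x * lap w x :=
    integrable_mul_of_hasCompactSupport (huc.mul huc) (hw2.lap (m := 0) (by norm_num)).continuous
      hwc.lap
  have hstab1 : p * ∫ x, u x ^ (p + 1) * φ x ^ 2 ≤ ∫ x, lap (fun x => u x * φ x) x ^ 2 := by
    refine le_trans (le_of_eq ?_) (hstab _ huφ huφc)
    rw [← integral_const_mul]
    congr 1 with x
    rw [show p + 1 = (p - 1) + 2 by ring, Real.rpow_add (hpos x), Real.rpow_two]
    ring
  have hgreen : ∫ x, lap u x * lap (fun x => u x * (φ x * φ x)) x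
      = ∫ x, u x ^ (p + 1) * φ x ^ 2 := by
    rw [integral_mul_lap_comm hLu huφφ huφφc]
    congr 1 with x
    rw [heq, Real.rpow_add (hpos x), Real.rpow_one]
    ring
  have hL := integral_mono iL (((iM.add (iG.const_mul 8)).add (iQ.const_mul 2)).add
    (iB.const_mul 2)) fun x => by
      have h1 := (lap_mul_sq_le hu2 hφ2 x).1
      have h2 := mul_le_mul_of_nonneg_left (hlap x) (sq_nonneg (u x))
      simp only [Pi.add_apply]
      linarith
  rw [integral_add' ((iM.add (iG.const_mul 8)).add (iQ.const_mul 2)) (iB.const_mul 2),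
    integral_add' (iM.add (iG.const_mul 8)) (iQ.const_mul 2), integral_add' iM (iG.const_mul 8),
    integral_const_mul, integral_const_mul, integral_const_mul, hgreen] at hL
  have hA := integral_mono iA (((iL.const_mul 2).add (iG.const_mul 16)).add (iQ.const_mul 4))
    fun x => by
      have h1 := (lap_mul_sq_le hu2 hφ2 x).2
      have h2 := mul_le_mul_of_nonneg_left (hlap x) (sq_nonneg (u x))
      simp only [Pi.add_apply]
      linarith
  rw [integral_add' ((iL.const_mul 2).add (iG.const_mul 16)) (iQ.const_mul 4),
    integral_add' (iL.const_mul 2) (iG.const_mul 16),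
    integral_const_mul, integral_const_mul, integral_const_mul] at hA
  have hG := integral_mono (iG.const_mul 2) (iW.add (iB.const_mul 2)) fun x => by
    have h1 := neg_le_abs (u x * lap u x)
    have h2 := mul_le_mul_of_nonneg_right h1 (hw0 x)
    simp only [Pi.add_apply]
    rw [lap_mul_self hu2]
    change 2 * (e x * w x) ≤ (2 * u x * lap u x + 2 * e x) * w x + _
    linarith
  rw [integral_add' iW (iB.const_mul 2), integral_const_mul, integral_const_mul,
    ← integral_mul_lap_comm (hu2.mul hu2) hw2 hwc] at hG
  have hW := integral_mono iW' iQ fun x => by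
    have := mul_le_mul_of_nonneg_left ((le_abs_self _).trans (hlapw x)) (mul_self_nonneg (u x))
    simpa only [sq] using this
  have hB := integral_mono iB ((iA.const_mul (1 / (2 * κ))).add (iQ.const_mul (κ / 2)))
    fun x => by
      simp only [Pi.add_apply]
      have hq0 : 0 ≤ q x := (sq_nonneg _).trans (hlap x)
      have hκ0 : 0 < κ := by linarith
      have hrhs : 0 ≤ 1 / (2 * κ) * (lap u x ^ 2 * φ x ^ 2) + κ / 2 * (u x ^ 2 * q x) := by
        positivity
      refine abs_le_of_sq_le_sq' ?_ hrhs |>.2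
      rw [mul_pow, sq_abs]
      have h1 : (u x * lap u x) ^ 2 * w x ^ 2 ≤ (u x * lap u x) ^ 2 * (q x * φ x ^ 2) :=
        mul_le_mul_of_nonneg_left (hw x) (sq_nonneg _)
      have h2 : 1 / (2 * κ) * (κ / 2) = 1 / 4 := by field_simp; norm_num
      nlinarith [sq_nonneg (1 / (2 * κ) * (lap u x ^ 2 * φ x ^ 2) - κ / 2 * (u x ^ 2 * q x))]
  rw [integral_add' (iA.const_mul (1 / (2 * κ))) (iQ.const_mul (κ / 2)), integral_const_mul,
    integral_const_mul] at hB
  have hA0 : 0 ≤ ∫ x, lap u x ^ 2 * φ x ^ 2 := integral_nonneg fun x => by positivity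
  generalize (∫ x, lap u x ^ 2 * φ x ^ 2) = A at *
  generalize (∫ x, u x ^ (p + 1) * φ x ^ 2) = I at *
  generalize (∫ x, u x ^ 2 * q x) = Q at *
  generalize (∫ x, |u x * lap u x| * w x) = B at *
  generalize (∫ x, e x * w x) = G at *
  have hI : I ≤ 6 * t * Q + 10 * t * B := by
    have h1 : (p - 1) * I ≤ 6 * Q + 10 * B := by linarith
    have h2 := mul_le_mul_of_nonneg_left h1 ht0.le
    have h3 : t * ((p - 1) * I) = I := by rw [ht]; field_simp
    linarith
  have hA1 : A ≤ (24 + 12 * t) * Q + κ * B := by rw [hκ]; linarith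
  have hA2 : A ≤ (48 + 24 * t + κ ^ 2) * Q := by
    have h1 := mul_le_mul_of_nonneg_left hB (by linarith : 0 ≤ κ)
    have h2 : κ * (1 / (2 * κ) * A + κ / 2 * Q) = A / 2 + κ ^ 2 / 2 * Q := by field_simp
    linarith
  have hB1 : B ≤ A / 2 + κ / 2 * Q := by
    have : 1 / (2 * κ) ≤ 1 / 2 := by
      apply one_div_le_one_div_of_le <;> linarith
    nlinarith
  have h1 := mul_le_mul_of_nonneg_left hB1 (by positivity : 0 ≤ 10 * t)
  have h2 := mul_le_mul_of_nonneg_left hA2 (by positivity : 0 ≤ 1 + 5 * t)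
  linarith

end Energy

section Cutoff

variable {N : ℕ} {η h : EuclideanSpace ℝ (Fin N) → ℝ}

lemma exists_pd_pow_mul_eq (hη : ContDiff ℝ (⊤ : ℕ∞) η) (hh : ContDiff ℝ (⊤ : ℕ∞) h) (k : ℕ)
    (i : Fin N) : ∃ g : EuclideanSpace ℝ (Fin N) → ℝ, ContDiff ℝ (⊤ : ℕ∞) g ∧
      pd i (fun x => η x ^ (k + 1) * h x) = fun x => η x ^ k * g x := by
  have hη1 : Differentiable ℝ η := hη.differentiable (by simp)
  refine ⟨fun x => η x * pd i h x + h x * ((k + 1) * pd i η x),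
    (hη.mul (hh.pd (by simp) i)).add (hh.mul (contDiff_const.mul (hη.pd (by simp) i))), ?_⟩
  rw [pd_mul (hη1.fun_pow _) (hh.differentiable (by simp))]
  ext x
  have : pd i (fun x => η x ^ (k + 1)) x = (k + 1) * η x ^ k * pd i η x := by
    simp [pd, fderiv_fun_pow (k + 1) (hη1 x)]
  rw [this]
  ring

lemma exists_lap_pow_mul_eq (hη : ContDiff ℝ (⊤ : ℕ∞) η) (hh : ContDiff ℝ (⊤ : ℕ∞) h) (k : ℕ) :
    ∃ g : EuclideanSpace ℝ (Fin N) → ℝ, ContDiff ℝ (⊤ : ℕ∞) g ∧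
      lap (fun x => η x ^ (k + 2) * h x) = fun x => η x ^ k * g x := by
  choose g₁ hg₁ h₁ using exists_pd_pow_mul_eq hη hh (k + 1)
  choose g₂ hg₂ h₂ using fun i => exists_pd_pow_mul_eq hη (hg₁ i) k i
  refine ⟨fun x => ∑ i, g₂ i x, ContDiff.sum fun i _ => hg₂ i, ?_⟩
  ext x
  simp only [lap_eq_sum_pd, h₁, h₂, Finset.mul_sum]

lemma exists_abs_pow_mul_le (hηc : HasCompactSupport η) (hη0 : ∀ x, 0 ≤ η x)
    (hh : Continuous h) {k : ℕ} (hk : k ≠ 0) :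
    ∃ M : ℝ, 0 ≤ M ∧ ∀ x, |η x ^ k * h x| ≤ M * η x ^ k := by
  obtain ⟨M, hM⟩ := hηc.isCompact.exists_bound_of_continuousOn hh.continuousOn
  refine ⟨|M|, abs_nonneg _, fun x => ?_⟩
  by_cases hx : η x = 0
  · simp [hx, hk]
  · rw [abs_mul, abs_of_nonneg (pow_nonneg (hη0 x) k), mul_comm]
    exact mul_le_mul_of_nonneg_right ((hM x (subset_tsupport η hx)).trans (le_abs_self M))
      (pow_nonneg (hη0 x) k)

/-- Derivative bounds for powers of a cutoff function, in terms of lower powers. -/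
lemma exists_bounds_pow (hη : ContDiff ℝ (⊤ : ℕ∞) η) (hηc : HasCompactSupport η)
    (hη0 : ∀ x, 0 ≤ η x) {k : ℕ} (hk : k ≠ 0) : ∃ K : ℝ, 0 < K ∧ ∀ x,
      (∑ i, pd i (fun y => η y ^ (k + 2)) x ^ 2) ^ 2
          ≤ K * η x ^ (2 * k) * (η x ^ (k + 2)) ^ 2 ∧
      lap (fun y => η y ^ (k + 2)) x ^ 2 ≤ K * η x ^ (2 * k) ∧
      |lap (fun y => ∑ i, pd i (fun y => η y ^ (k + 2)) y ^ 2) x| ≤ K * η x ^ (2 * k) := by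
  have hone : ContDiff ℝ (⊤ : ℕ∞) fun _ : EuclideanSpace ℝ (Fin N) => (1 : ℝ) := contDiff_const
  choose g hg hpd using exists_pd_pow_mul_eq hη hone (k + 1)
  obtain ⟨a, ha, hlap⟩ := exists_lap_pow_mul_eq hη hone k
  simp only [mul_one] at hpd hlap
  have hgs : ContDiff ℝ (⊤ : ℕ∞) fun x => ∑ i, g i x ^ 2 := ContDiff.sum fun i _ => (hg i).pow 2
  have hW : (fun y => ∑ i, pd i (fun y => η y ^ (k + 2)) y ^ 2)
      = fun y => η y ^ (2 * k + 2) * ∑ i, g i y ^ 2 := by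
    ext y
    simp only [hpd, Finset.mul_sum]
    exact Finset.sum_congr rfl fun i _ => by ring
  obtain ⟨b, hb, hlapW⟩ := exists_lap_pow_mul_eq hη hgs (2 * k)
  obtain ⟨M₁, hM₁, h₁⟩ := exists_abs_pow_mul_le hηc hη0 hgs.continuous (k := 2 * k + 2) (by simp)
  obtain ⟨M₂, hM₂, h₂⟩ := exists_abs_pow_mul_le hηc hη0 ha.continuous hk
  obtain ⟨M₃, hM₃, h₃⟩ := exists_abs_pow_mul_le hηc hη0 hb.continuous (k := 2 * k) (by simpa)
  refine ⟨M₁ ^ 2 + M₂ ^ 2 + M₃ + 1, by positivity, fun x => ⟨?_, ?_, ?_⟩⟩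
  · rw [show (∑ i, pd i (fun y => η y ^ (k + 2)) x ^ 2) = _ from congrFun hW x]
    have h := sq_le_sq' (neg_le_of_abs_le (h₁ x)) (le_of_abs_le (h₁ x))
    have hx := hη0 x
    have h' : 0 ≤ (M₂ ^ 2 + M₃ + 1) * (η x ^ (2 * k) * (η x ^ (k + 2)) ^ 2) := by positivity
    have e : (M₁ * η x ^ (2 * k + 2)) ^ 2 = M₁ ^ 2 * (η x ^ (2 * k) * (η x ^ (k + 2)) ^ 2) := by
      ring
    linarith
  · rw [hlap]
    have h := sq_le_sq' (neg_le_of_abs_le (h₂ x)) (le_of_abs_le (h₂ x))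
    have hx := hη0 x
    have h' : 0 ≤ (M₁ ^ 2 + M₃ + 1) * η x ^ (2 * k) := by positivity
    have e : (M₂ * η x ^ k) ^ 2 = M₂ ^ 2 * η x ^ (2 * k) := by ring
    linarith
  · rw [hW, hlapW]
    have hx := hη0 x
    have h' : 0 ≤ (M₁ ^ 2 + M₂ ^ 2 + 1) * η x ^ (2 * k) := by positivity
    linarith [h₃ x]

/-- Cutoff functions at scale `R` with derivative bounds uniform in `R`. -/
lemma exists_cutoff (N : ℕ) {k : ℕ} (hk : k ≠ 0) : ∃ K : ℝ, 0 < K ∧ ∀ R : ℝ, 0 < R →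
    ∃ ζ : EuclideanSpace ℝ (Fin N) → ℝ, ContDiff ℝ (⊤ : ℕ∞) ζ ∧ HasCompactSupport ζ ∧
      (∀ x, 0 ≤ ζ x) ∧ (∀ x, ζ x ≤ 1) ∧ (∀ x ∈ Metric.ball 0 R, ζ x = 1) ∧
      (∀ x ∉ Metric.ball 0 (2 * R), ζ x = 0) ∧ ∀ x,
      (∑ i, pd i (fun y => ζ y ^ (k + 2)) x ^ 2) ^ 2
          ≤ K * R⁻¹ ^ 4 * ζ x ^ (2 * k) * (ζ x ^ (k + 2)) ^ 2 ∧
      lap (fun y => ζ y ^ (k + 2)) x ^ 2 ≤ K * R⁻¹ ^ 4 * ζ x ^ (2 * k) ∧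
      |lap (fun y => ∑ i, pd i (fun y => ζ y ^ (k + 2)) y ^ 2) x|
          ≤ K * R⁻¹ ^ 4 * ζ x ^ (2 * k) := by
  let η : ContDiffBump (0 : EuclideanSpace ℝ (Fin N)) := ⟨1, 2, one_pos, one_lt_two⟩
  have hη : ContDiff ℝ (⊤ : ℕ∞) η := η.contDiff
  obtain ⟨K, hK, hb⟩ := exists_bounds_pow hη η.hasCompactSupport (fun x => η.nonneg) hk
  refine ⟨K, hK, fun R hR => ⟨fun x => η (R⁻¹ • x), hη.comp (contDiff_const_smul _),
    η.hasCompactSupport.comp_homeomorph (Homeomorph.smulOfNeZero R⁻¹ (inv_pos.2 hR).ne'),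
    fun x => η.nonneg, fun x => η.le_one, fun x hx => ?_, fun x hx => ?_, fun x => ?_⟩⟩
  · refine η.one_of_mem_closedBall ?_
    rw [mem_ball_zero_iff] at hx
    rw [mem_closedBall_zero_iff, norm_smul, norm_inv, Real.norm_of_nonneg hR.le,
      inv_mul_le_one₀ hR]
    exact hx.le
  · refine η.zero_of_le_dist ?_
    rw [mem_ball_zero_iff, not_lt] at hx
    rw [dist_zero_right, norm_smul, norm_inv, Real.norm_of_nonneg hR.le, le_inv_mul_iff₀ hR]
    linarith
  · set Φ : EuclideanSpace ℝ (Fin N) → ℝ := fun y => η y ^ (k + 2) with hΦ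
    have hΦs : ContDiff ℝ (⊤ : ℕ∞) Φ := hη.pow _
    set W : EuclideanSpace ℝ (Fin N) → ℝ := fun y => ∑ i, pd i Φ y ^ 2 with hWdef
    have htwo : (2 : WithTop ℕ∞) ≤ ((⊤ : ℕ∞) : WithTop ℕ∞) := WithTop.coe_le_coe.2 le_top
    have hW : ContDiff ℝ 2 W :=
      ContDiff.of_le (ContDiff.sum fun i _ => (hΦs.pd (by simp) i).pow 2) htwo
    have hpd (i) : pd i (fun y => Φ (R⁻¹ • y)) = _ := pd_comp_smul R⁻¹ Φ i
    have hWR : (fun y => ∑ i, pd i (fun y => Φ (R⁻¹ • y)) y ^ 2)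
        = fun y => R⁻¹ ^ 2 * W (R⁻¹ • y) := by
      ext y
      simp only [hpd, hWdef, mul_pow, Finset.mul_sum]
    obtain ⟨h₁, h₂, h₃⟩ := hb (R⁻¹ • x)
    have hWc : ContDiff ℝ 2 fun y => W (R⁻¹ • y) := hW.comp (contDiff_const_smul _)
    have hR2 : 0 ≤ R⁻¹ ^ 4 := by positivity
    change (∑ i, pd i (fun y => Φ (R⁻¹ • y)) x ^ 2) ^ 2 ≤ _ ∧
      lap (fun y => Φ (R⁻¹ • y)) x ^ 2 ≤ _ ∧
      |lap (fun y => ∑ i, pd i (fun y => Φ (R⁻¹ • y)) y ^ 2) x| ≤ _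
    refine ⟨?_, ?_, ?_⟩
    · rw [show (∑ i, pd i (fun y => Φ (R⁻¹ • y)) x ^ 2) = _ from congrFun hWR x]
      linarith [mul_le_mul_of_nonneg_left h₁ hR2]
    · rw [lap_comp_smul _ (hΦs.of_le htwo)]
      linarith [mul_le_mul_of_nonneg_left h₂ hR2]
    · rw [hWR, lap_const_mul _ hWc, lap_comp_smul _ hW]
      dsimp only
      rw [← mul_assoc, abs_mul, abs_of_nonneg (by positivity)]
      linarith [mul_le_mul_of_nonneg_left h₃ hR2]

end Cutoff

lemma mul_sq_mul_pow_le {p U z c : ℝ} {k : ℕ} (hp : 1 < p) (hU : 0 < U) (hz0 : 0 ≤ z)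
    (hz1 : z ≤ 1) (hc : 0 ≤ c) (hk : 4 ≤ k * (p - 1)) :
    c * (U ^ 2 * z ^ (2 * k)) ≤ 2 / (p + 1) * (U ^ (p + 1) * (z ^ (k + 2)) ^ 2)
      + (1 - 2 / (p + 1)) * c ^ ((p + 1) / (p - 1)) := by
  have hp1 : 0 < p - 1 := by linarith
  have hp2 : 0 < p + 1 := by linarith
  have hconj : ((p + 1) / 2).HolderConjugate ((p + 1) / (p - 1)) := by
    rw [Real.holderConjugate_iff]
    constructor
    · linarith
    · field_simp
      ring
  have hX : 0 ≤ U ^ 2 * z ^ (2 * k) := by positivity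
  have hpow : (U ^ 2 * z ^ (2 * k)) ^ ((p + 1) / 2) ≤ U ^ (p + 1) * (z ^ (k + 2)) ^ 2 := by
    rw [Real.mul_rpow (by positivity) (by positivity), ← Real.rpow_natCast U 2,
      ← Real.rpow_mul hU.le, ← Real.rpow_natCast z (2 * k), ← Real.rpow_mul hz0, ← pow_mul,
      ← Real.rpow_natCast z ((k + 2) * 2)]
    rw [show ((2 : ℕ) : ℝ) * ((p + 1) / 2) = p + 1 by push_cast; ring]
    refine mul_le_mul_of_nonneg_left ?_ (by positivity)
    refine Real.rpow_le_rpow_of_exponent_ge' hz0 hz1 (by positivity) ?_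
    push_cast
    linarith
  have hy := Real.young_inequality_of_nonneg hX hc hconj
  have e₁ : (U ^ 2 * z ^ (2 * k)) ^ ((p + 1) / 2) / ((p + 1) / 2)
      = 2 / (p + 1) * (U ^ 2 * z ^ (2 * k)) ^ ((p + 1) / 2) := by field_simp
  have e₂ : c ^ ((p + 1) / (p - 1)) / ((p + 1) / (p - 1))
      = (1 - 2 / (p + 1)) * c ^ ((p + 1) / (p - 1)) := by
    rw [show 1 - 2 / (p + 1) = (p - 1) / (p + 1) by field_simp; ring]
    field_simp
  rw [e₁, e₂] at hy
  have := mul_le_mul_of_nonneg_left hpow (by positivity : 0 ≤ 2 / (p + 1))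
  linarith

/-- Decay estimate for classical stable solutions of `Δ²u = u^p`, `u > 0` in `ℝ^N`:
`∫_{B_R} (v² + u^{p+1}) ≤ C R^{N-4-8/(p-1)}` with `v = -Δu`. -/
theorem decay_estimate_stable_solution
    (N : ℕ) (hN : 5 ≤ N) (p : ℝ) (hp : 1 < p)
    (u : EuclideanSpace ℝ (Fin N) → ℝ)
    (hu : ContDiff ℝ 4 u) (hpos : ∀ x, 0 < u x)
    (heq : ∀ x, lap (lap u) x = u x ^ p)
    (hstable : ∀ φ : EuclideanSpace ℝ (Fin N) → ℝ, ContDiff ℝ (⊤ : ℕ∞) φ →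
      HasCompactSupport φ →
      p * ∫ x, u x ^ (p - 1) * φ x ^ 2 ≤ ∫ x, (lap φ x) ^ 2) :
    ∃ C : ℝ, 0 < C ∧ ∀ R : ℝ, 0 < R →
      ∫ x in Metric.ball (0 : EuclideanSpace ℝ (Fin N)) R,
          ((-(lap u x)) ^ 2 + u x ^ (p + 1))
        ≤ C * R ^ ((N : ℝ) - 4 - 8 / (p - 1)) := by
  obtain ⟨C, hC, henergy⟩ := exists_energy_le (N := N) hp
  have hp1 : 0 < p - 1 := by linarith
  have hp2 : 0 < p + 1 := by linarith
  obtain ⟨k, hk⟩ := exists_nat_ge (4 / (p - 1))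
  have hk4 : 4 ≤ k * (p - 1) := (div_le_iff₀ hp1).1 hk
  have hk0 : k ≠ 0 := by
    rintro rfl
    simp at hk4
    linarith
  obtain ⟨K, hK, hcut⟩ := exists_cutoff N hk0
  have hcont (r : ℝ) : Continuous fun x => u x ^ r :=
    hu.continuous.rpow_const fun x => Or.inl (hpos x).ne'
  have hLc : Continuous (lap u) := (hu.lap (m := 2) (by norm_num)).continuous
  have hstab : ∀ ψ : EuclideanSpace ℝ (Fin N) → ℝ, ContDiff ℝ 2 ψ → HasCompactSupport ψ →
      ∫ x, p * u x ^ (p - 1) * ψ x ^ 2 ≤ ∫ x, lap ψ x ^ 2 := fun ψ hψ hψc => by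
    refine integral_mul_sq_le_of_contDiff_two (continuous_const.mul (hcont _))
      (fun φ hφ hφc => ?_) hψ hψc
    simp only [mul_assoc, integral_const_mul]
    exact hstable φ hφ hφc
  set b : ℝ := (p + 1) / (p - 1) with hb
  set V : ℝ := volume.real (Metric.ball (0 : EuclideanSpace ℝ (Fin N)) 1) with hV
  have hV0 : 0 < V := ENNReal.toReal_pos (Metric.measure_ball_pos _ _ one_pos).ne'
    measure_ball_lt_top.ne
  refine ⟨(C * K) ^ b * (2 ^ N * V), by positivity, fun R hR => ?_⟩
  obtain ⟨ζ, hζ, hζc, hζ0, hζ1, hone, hzero, hbd⟩ := hcut R hR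
  set φ : EuclideanSpace ℝ (Fin N) → ℝ := fun x => ζ x ^ (k + 2) with hφdef
  have hφ : ContDiff ℝ (⊤ : ℕ∞) φ := hζ.pow _
  have hpowc {n : ℕ} (hn : n ≠ 0) : HasCompactSupport fun x => ζ x ^ n :=
    hζc.comp_left (g := fun t : ℝ => t ^ n) (zero_pow hn)
  have hφc : HasCompactSupport φ := hpowc (by simp)
  have hφ2c : HasCompactSupport fun x => φ x ^ 2 :=
    hφc.comp_left (g := fun t : ℝ => t ^ 2) (zero_pow two_ne_zero)
  set q : EuclideanSpace ℝ (Fin N) → ℝ := fun x => K * R⁻¹ ^ 4 * ζ x ^ (2 * k) with hq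
  have hqcont : Continuous q := continuous_const.mul (hζ.continuous.pow _)
  have hqc : HasCompactSupport q := (hpowc (by simpa)).mul_left
  have key := henergy u hu hpos heq hstab φ q (hφ.of_le (WithTop.coe_le_coe.2 le_top)) hφc hqcont
    hqc (fun x => (hbd x).1) (fun x => (hbd x).2.1) (fun x => (hbd x).2.2)
  have iA : Integrable fun x => lap u x ^ 2 * φ x ^ 2 :=
    integrable_mul_of_hasCompactSupport (hLc.pow 2) (hφ.continuous.pow 2) hφ2c
  have iI : Integrable fun x => u x ^ (p + 1) * φ x ^ 2 :=
    integrable_mul_of_hasCompactSupport (hcont _) (hφ.continuous.pow 2) hφ2c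
  have iQ : Integrable fun x => u x ^ 2 * q x :=
    integrable_mul_of_hasCompactSupport (hu.continuous.pow 2) hqcont hqc
  set c : ℝ := C * (K * R⁻¹ ^ 4) with hc
  have hc0 : 0 < c := by positivity
  have iS : Integrable ((Metric.ball (0 : EuclideanSpace ℝ (Fin N)) (2 * R)).indicator
      fun _ => (1 - 2 / (p + 1)) * c ^ b) :=
    (integrable_indicator_iff measurableSet_ball).2
      (integrableOn_const measure_ball_lt_top.ne)
  have hY := integral_mono (iQ.const_mul C) ((iI.const_mul (2 / (p + 1))).add iS) fun x => by
    simp only [Pi.add_apply]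
    by_cases hx : x ∈ Metric.ball (0 : EuclideanSpace ℝ (Fin N)) (2 * R)
    · rw [indicator_of_mem hx]
      refine le_trans (le_of_eq ?_)
        (mul_sq_mul_pow_le hp (hpos x) (hζ0 x) (hζ1 x) hc0.le hk4)
      simp only [hq, hc]
      ring
    · rw [indicator_of_notMem hx]
      simp [hq, hφdef, hzero x hx, hk0]
  rw [integral_add' (iI.const_mul _) iS, integral_const_mul, integral_const_mul,
    integral_indicator measurableSet_ball, setIntegral_const, smul_eq_mul] at hY
  have hvol : volume.real (Metric.ball (0 : EuclideanSpace ℝ (Fin N)) (2 * R))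
      = (2 * R) ^ N * V := by
    rw [measureReal_def, Measure.addHaar_ball_of_pos _ _ (by positivity), ENNReal.toReal_mul,
      ENNReal.toReal_ofReal (by positivity), finrank_euclideanSpace_fin, hV, measureReal_def]
  rw [hvol] at hY
  have hlocal : ∫ x in Metric.ball (0 : EuclideanSpace ℝ (Fin N)) R,
      ((-(lap u x)) ^ 2 + u x ^ (p + 1))
      ≤ (∫ x, lap u x ^ 2 * φ x ^ 2) + ∫ x, u x ^ (p + 1) * φ x ^ 2 := by
    rw [← integral_add iA iI]
    refine le_trans (le_of_eq ?_) (setIntegral_le_integral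
      (s := Metric.ball (0 : EuclideanSpace ℝ (Fin N)) R) (iA.add iI) (ae_of_all _ fun x => ?_))
    · refine setIntegral_congr_fun measurableSet_ball fun x hx => ?_
      simp [hφdef, hone x hx]
    · have := hpos x
      simp only [Pi.add_apply, Pi.zero_apply]
      positivity
  refine hlocal.trans ?_
  have hA0 : 0 ≤ ∫ x, lap u x ^ 2 * φ x ^ 2 := integral_nonneg fun x => by positivity
  have hscale : (C * K) ^ b * (2 ^ N * V) * R ^ ((N : ℝ) - 4 - 8 / (p - 1))
      = (2 * R) ^ N * V * c ^ b := by
    have e₁ : (N : ℝ) - 4 - 8 / (p - 1) = N + (-4) * b := by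
      rw [hb]; field_simp; ring
    have e₂ : c = C * K * R ^ (-4 : ℝ) := by
      rw [hc, Real.rpow_neg hR.le, inv_pow, ← mul_assoc]
      norm_cast
    rw [e₁, e₂, Real.rpow_add hR, Real.mul_rpow (x := C * K) (by positivity) (by positivity),
      ← Real.rpow_mul hR.le, Real.rpow_natCast, mul_pow]
    ring
  rw [hscale]
  have hθ : 0 < 1 - 2 / (p + 1) := by
    rw [sub_pos, div_lt_one hp2]
    linarith
  have hθ1 : 0 ≤ 2 / (p + 1) := by positivity
  generalize (∫ x, lap u x ^ 2 * φ x ^ 2) = A at *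
  generalize (∫ x, u x ^ (p + 1) * φ x ^ 2) = I at *
  refine le_of_mul_le_mul_left ?_ hθ
  have := mul_nonneg hθ1 hA0
  linarith
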